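/- Let m, n, r, s, i₀ be integers with 0 < n < m, r + s = m, and 1 ≤ i₀ ≤ n + 1. Let ε : {1, …, n} → {±1} and ε₀ ∈ {±1}. For each index i ∈ {1, …, n+1} with i ≠ i₀ define a pair of integers (rᵢ, sᵢ) as follows: if i < i₀ then (rᵢ, sᵢ) = (1, 0) when ε(i) = (−1)^{i−1} and (rᵢ, sᵢ) = (0, 1) when ε(i) = (−1)^{i}; if i > i₀ then (rᵢ, sᵢ) = (1, 0) when ε(i−1) = (−1)^{i+m−n−2} and (rᵢ, sᵢ) = (0, 1) when ε(i−1) = (−1)^{i+m−n−1}. Set r_{i₀} = r − Σ_{i≠i₀} rᵢ and s_{i₀} = s − Σ_{i≠i₀} sᵢ. Then ε(1)·ε(2)···ε(n)·ε₀ = (−1)^{(r−s)(r−s−1)/2} if and only if ε₀ = (−1)^{r_{i₀}(i₀−1) + s_{i₀}·i₀ + (m−n)(m−n−1)/2}. -/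

import Mathlib

theorem aux_zpow (k l t : ℤ) (h : k = l + 2 * t) : (-1 : ℤˣ) ^ k = (-1 : ℤˣ) ^ l := by
  have h2 : (-1 : ℤˣ) ^ (2 : ℤ) = 1 := by decide
  rw [h, zpow_add, zpow_mul, h2, one_zpow, mul_one]

theorem aux_dich (e : ℤˣ) (k : ℤ) : e = (-1 : ℤˣ) ^ k ∨ e = (-1 : ℤˣ) ^ (k + 1) := by
  rcases Int.even_or_odd k with hk | hk
  · rw [hk.add_one.neg_one_zpow, hk.neg_one_zpow]
    exact Int.units_eq_one_or e
  · rw [hk.add_one.neg_one_zpow, hk.neg_one_zpow]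
    exact (Int.units_eq_one_or e).symm

theorem aux_gauss (n : ℤ) (hn : 0 ≤ n) : 2 * ∑ j ∈ Finset.Icc 1 n, (j - 1) = n * (n - 1) := by
  induction n, hn using Int.le_induction with
  | base => simp
  | succ k hk ih =>
    have : Finset.Icc 1 (k + 1) = insert (k + 1) (Finset.Icc 1 k) := by
      ext x; simp only [Finset.mem_Icc, Finset.mem_insert]; omega
    rw [this, Finset.sum_insert (by simp), mul_add, ih]
    ring

theorem aux_prod (s : Finset ℤ) (g : ℤ → ℤ) :
    ∏ j ∈ s, (-1 : ℤˣ) ^ (g j) = (-1 : ℤˣ) ^ (∑ j ∈ s, g j) := by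
  induction s using Finset.induction_on with
  | empty => simp
  | insert a s ha ih => rw [Finset.prod_insert ha, Finset.sum_insert ha, zpow_add, ih]

theorem aux_reindex (n i₀ : ℤ) (hi₀ : 1 ≤ i₀) (hi₀' : i₀ ≤ n + 1) (F : ℤ → ℤ) :
    ∑ i ∈ (Finset.Icc 1 (n + 1)).erase i₀, F i
      = ∑ j ∈ Finset.Icc 1 n, F (if j < i₀ then j else j + 1) := by
  have : (Finset.Icc 1 (n + 1)).erase i₀
      = (Finset.Icc 1 n).image (fun j => if j < i₀ then j else j + 1) := by
    ext x
    simp only [Finset.mem_erase, Finset.mem_Icc, Finset.mem_image]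
    constructor
    · rintro ⟨h1, h2, h3⟩
      by_cases hx : x < i₀
      · exact ⟨x, by omega, by simp [hx]⟩
      · exact ⟨x - 1, by omega, by rw [if_neg (by omega)]; ring⟩
    · rintro ⟨j, hj, rfl⟩
      split_ifs <;> omega
  rw [this, Finset.sum_image]
  intro a _ b _ hab
  simp only at hab
  split_ifs at hab <;> omega


/-- Lemma on characters of A-packet component groups (Ichino, Lemma 5.1 / `l:eta'`):
for the A-parameter `φ' = χ_{μ₁} ⊕ ⋯ ⊕ χ_{μ_n} ⊕ (χ_{μ₀} ⊠ S_{m−n})` for `U_m`, a character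
encoded by signs `ε i = η'(e'ᵢ)` and `ε₀ = η'(e'₀)` satisfies
`η'(e'₁+⋯+e'_n+e'₀) = (−1)^{(r−s)(r−s−1)/2}` iff
`ε₀ = (−1)^{r_{i₀}(i₀−1) + s_{i₀} i₀ + (m−n)(m−n−1)/2}`. -/
theorem statement0 (m n r s i₀ : ℤ)
    (hn : 0 < n) (hm : n < m) (hrs : r + s = m)
    (hi₀ : 1 ≤ i₀) (hi₀' : i₀ ≤ n + 1)
    (ε : ℤ → ℤˣ) (ε₀ : ℤˣ) (R S : ℤ → ℤ)
    (hlt : ∀ i, 1 ≤ i → i < i₀ →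
      (ε i = (-1 : ℤˣ) ^ (i - 1) → R i = 1 ∧ S i = 0) ∧
      (ε i = (-1 : ℤˣ) ^ i → R i = 0 ∧ S i = 1))
    (hgt : ∀ i, i₀ < i → i ≤ n + 1 →
      (ε (i - 1) = (-1 : ℤˣ) ^ (i + m - n - 2) → R i = 1 ∧ S i = 0) ∧
      (ε (i - 1) = (-1 : ℤˣ) ^ (i + m - n - 1) → R i = 0 ∧ S i = 1)) :
    (∏ i ∈ Finset.Icc 1 n, ε i) * ε₀ = (-1 : ℤˣ) ^ ((r - s) * (r - s - 1) / 2) ↔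
      ε₀ = (-1 : ℤˣ) ^
        ((r - ∑ i ∈ (Finset.Icc 1 (n + 1)).erase i₀, R i) * (i₀ - 1)
          + (s - ∑ i ∈ (Finset.Icc 1 (n + 1)).erase i₀, S i) * i₀
          + (m - n) * (m - n - 1) / 2) := by
  have key : ∀ j ∈ Finset.Icc 1 n,
      ε j = (-1 : ℤˣ) ^ ((j - 1) + (if j < i₀ then 0 else m - n)
        + S (if j < i₀ then j else j + 1)) ∧
      R (if j < i₀ then j else j + 1) = 1 - S (if j < i₀ then j else j + 1) := by
    intro j hj
    rw [Finset.mem_Icc] at hj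
    by_cases hji : j < i₀
    · simp only [if_pos hji]
      obtain ⟨h1, h2⟩ := hlt j hj.1 hji
      rcases aux_dich (ε j) (j - 1) with h | h
      · obtain ⟨hR, hS⟩ := h1 h
        rw [hR, hS, h]; exact ⟨by congr 1; ring, by norm_num⟩
      · obtain ⟨hR, hS⟩ := h2 (by rw [h]; congr 1; ring)
        rw [hR, hS, h]; exact ⟨by congr 1; ring, by norm_num⟩
    · simp only [if_neg hji]
      obtain ⟨h1, h2⟩ := hgt (j + 1) (by omega) (by omega)
      rw [add_sub_cancel_right] at h1 h2
      rcases aux_dich (ε j) (j + 1 + m - n - 2) with h | h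
      · obtain ⟨hR, hS⟩ := h1 h
        rw [hR, hS, h]; exact ⟨by congr 1; ring, by norm_num⟩
      · obtain ⟨hR, hS⟩ := h2 (by rw [h]; congr 1; ring)
        rw [hR, hS, h]; exact ⟨by congr 1; ring, by norm_num⟩
  rw [aux_reindex n i₀ hi₀ hi₀' R, aux_reindex n i₀ hi₀ hi₀' S,
    Finset.prod_congr rfl (fun j hj => (key j hj).1), aux_prod,
    Finset.sum_congr rfl (fun j hj => (key j hj).2), Finset.sum_sub_distrib,
    Finset.sum_add_distrib, Finset.sum_add_distrib]
  have hc : ∑ j ∈ Finset.Icc 1 n, (if j < i₀ then 0 else m - n) = (n + 1 - i₀) * (m - n) := by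
    rw [Finset.sum_ite, Finset.sum_const_zero, zero_add, Finset.sum_const]
    have : (Finset.Icc 1 n).filter (fun j => ¬ j < i₀) = Finset.Icc i₀ n := by
      ext x; simp only [Finset.mem_filter, Finset.mem_Icc]; omega
    rw [this, Int.card_Icc, nsmul_eq_mul, Int.toNat_of_nonneg (by omega)]
  have hone : ∑ j ∈ Finset.Icc 1 n, (1 : ℤ) = n := by
    rw [Finset.sum_const, Int.card_Icc, nsmul_eq_mul, Int.toNat_of_nonneg (by omega)]; ring
  have hg := aux_gauss n hn.le
  rw [hc, hone]
  generalize ∑ j ∈ Finset.Icc 1 n, (j - 1) = G at *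
  generalize ∑ j ∈ Finset.Icc 1 n, S (if j < i₀ then j else j + 1) = σ
  have ha : 2 * ((r - s) * (r - s - 1) / 2) = (r - s) * (r - s - 1) :=
    Int.mul_ediv_cancel' (Int.even_mul_pred_self _).two_dvd
  have hb : 2 * ((m - n) * (m - n - 1) / 2) = (m - n) * (m - n - 1) :=
    Int.mul_ediv_cancel' (Int.even_mul_pred_self _).two_dvd
  generalize (r - s) * (r - s - 1) / 2 = a at *
  generalize (m - n) * (m - n - 1) / 2 = b at *
  rw [← eq_inv_mul_iff_mul_eq.symm.symm, ← zpow_neg, ← zpow_add]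
  subst hrs
  obtain ⟨t, ht⟩ : ∃ t, -(G + (n + 1 - i₀) * (r + s - n) + σ) + a
      = ((r - (n - σ)) * (i₀ - 1) + (s - σ) * i₀ + b) + 2 * t := by
    refine ⟨-(s * r), ?_⟩
    linarith
  rw [aux_zpow _ _ t ht]
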